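/- Let Λ be an artin algebra which is neither a Nakayama algebra, nor right 2-Nakayama, nor right 3-Nakayama. Then Λ is right 4-Nakayama if and only if every finitely generated indecomposable right Λ-module of length greater than 5 is uniserial and every finitely generated indecomposable right Λ-module of length 5 is local. -/

import Mathlib

/-! Basic definitions for (right) modules over a ring: radical, socle, length,
uniserial, local, indecomposable, `n`-factor serial, right `n`-Nakayama algebras,
Nakayama algebras and almost split sequences. -/

universe u v w

section ModuleDefs

variable (A : Type v) [Ring A] (M : Type w) [AddCommGroup M] [Module A M]

/-- The composition length of a module, i.e. the Krull dimension of its submodule lattice. -/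
noncomputable def moduleLength : WithBot ℕ∞ := Order.krullDim (Submodule A M)

/-- The radical of a module: the intersection of all its maximal submodules. -/
def moduleRad : Submodule A M := sInf {N : Submodule A M | IsCoatom N}

/-- The socle of a module: the sum of all its simple submodules. -/
def moduleSoc : Submodule A M := sSup {N : Submodule A M | IsAtom N}

variable {A M}

/-- The radical of a submodule `N`, viewed as a submodule of the ambient module. -/
def radOf (N : Submodule A M) : Submodule A M :=
  Submodule.map N.subtype (moduleRad A ↥N)

/-- The socle of a submodule `N`, viewed as a submodule of the ambient module. -/
def socOf (N : Submodule A M) : Submodule A M :=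
  Submodule.map N.subtype (moduleSoc A ↥N)

variable (A M)

/-- The iterated radical `rad^n(M)`, as a submodule of `M`. -/
def radPow : ℕ → Submodule A M
  | 0 => ⊤
  | n + 1 => radOf (radPow n)

/-- A module is uniserial if its submodules are totally ordered by inclusion. -/
def IsUniserialModule : Prop := ∀ N P : Submodule A M, N ≤ P ∨ P ≤ N

/-- A module is local if it has a unique maximal submodule. -/
def IsLocalModule : Prop := ∃! N : Submodule A M, IsCoatom N

/-- A module is colocal if its socle is a simple submodule. -/
def IsColocalModule : Prop := IsAtom (moduleSoc A M)

/-- A module is indecomposable if it is nonzero and is not the direct sum of two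
nonzero submodules. -/
def IsIndecModule : Prop :=
  Nontrivial M ∧ ∀ N P : Submodule A M, IsCompl N P → N = ⊥ ∨ P = ⊥

/-- The Loewy length of a module: the least `n` with `rad^n(M) = 0`. -/
noncomputable def loewyLength : ℕ := sInf {n : ℕ | radPow A M n = ⊥}

/-- A module `M` of length `l` is `n`-factor serial (`l ≥ n > 1`) if it is not uniserial,
`M/rad^{l-n}(M)` is uniserial and `M/rad^{l-n+1}(M)` is not uniserial. -/
def IsNFactorSerial (n : ℕ) : Prop :=
  1 < n ∧ ¬ IsUniserialModule A M ∧
  ∃ l : ℕ, moduleLength A M = l ∧ n ≤ l ∧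
    IsUniserialModule A (M ⧸ radPow A M (l - n)) ∧
    ¬ IsUniserialModule A (M ⧸ radPow A M (l - n + 1))

/-- `M` is `n`-factor serial, where `1`-factor serial means uniserial. -/
def IsFactorSerial (n : ℕ) : Prop :=
  (n = 1 ∧ IsUniserialModule A M) ∨ IsNFactorSerial A M n

end ModuleDefs

section AlgebraDefs

variable (Λ : Type u) [Ring Λ]

/-- A ring `Λ` is right `n`-Nakayama if every finitely generated indecomposable right
`Λ`-module is `i`-factor serial for some `1 ≤ i ≤ n`, and there is at least one finitely
generated indecomposable `n`-factor serial right `Λ`-module.  Right `Λ`-modules are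
realized as left `Λᵐᵒᵖ`-modules. -/
def IsRightNNakayama (n : ℕ) : Prop :=
  (∀ M : ModuleCat.{u} Λᵐᵒᵖ, Module.Finite Λᵐᵒᵖ M → IsIndecModule Λᵐᵒᵖ M →
      ∃ i, 1 ≤ i ∧ i ≤ n ∧ IsFactorSerial Λᵐᵒᵖ M i) ∧
  ∃ M : ModuleCat.{u} Λᵐᵒᵖ, Module.Finite Λᵐᵒᵖ M ∧ IsIndecModule Λᵐᵒᵖ M ∧
    IsNFactorSerial Λᵐᵒᵖ M n

/-- A ring `Λ` is a Nakayama algebra if every finitely generated indecomposable projective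
right `Λ`-module and every finitely generated indecomposable projective left `Λ`-module is
uniserial. -/
def IsNakayamaAlgebra : Prop :=
  (∀ M : ModuleCat.{u} Λᵐᵒᵖ, Module.Finite Λᵐᵒᵖ M → Module.Projective Λᵐᵒᵖ M →
      IsIndecModule Λᵐᵒᵖ M → IsUniserialModule Λᵐᵒᵖ M) ∧
  (∀ M : ModuleCat.{u} Λ, Module.Finite Λ M → Module.Projective Λ M →
      IsIndecModule Λ M → IsUniserialModule Λ M)

end AlgebraDefs

section AlmostSplit

variable {A : Type v} [Ring A]

/-- A pair of maps `f : X → Y`, `g : Y → Z` is an almost split (Auslander-Reiten) sequence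
if `0 → X → Y → Z → 0` is a non-split short exact sequence with `X` and `Z` indecomposable,
such that every homomorphism `V → Z` from a finitely generated module which is not a split
epimorphism factors through `g`. -/
def IsAlmostSplitSequence {X Y Z : Type w} [AddCommGroup X] [Module A X]
    [AddCommGroup Y] [Module A Y] [AddCommGroup Z] [Module A Z]
    (f : X →ₗ[A] Y) (g : Y →ₗ[A] Z) : Prop :=
  Function.Injective f ∧ Function.Surjective g ∧ LinearMap.range f = LinearMap.ker g ∧
  (¬ ∃ s : Z →ₗ[A] Y, g ∘ₗ s = LinearMap.id) ∧
  IsIndecModule A X ∧ IsIndecModule A Z ∧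
  ∀ V : ModuleCat.{w} A, Module.Finite A V →
    ∀ h : V →ₗ[A] Z, (¬ ∃ s : Z →ₗ[A] V, h ∘ₗ s = LinearMap.id) →
      ∃ k : V →ₗ[A] Y, g ∘ₗ k = h

end AlmostSplit

section RadicalSeries

variable {A : Type v} [Ring A] {M : Type w} [AddCommGroup M] [Module A M]

lemma isSemisimpleModule_quotient_moduleRad [IsArtinian A M] :
    IsSemisimpleModule A (M ⧸ moduleRad A M) :=
  (IsArtinian.isSemisimpleModule_iff_jacobson A _).mpr (Module.jacobson_quotient_jacobson A M)

lemma moduleRad_eq_smul_top [IsArtinianRing A] :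
    moduleRad A M = Ring.jacobson A • (⊤ : Submodule A M) := by
  refine le_antisymm (Module.jacobson_le_of_eq_bot ?_) (Ring.jacobson_smul_top_le A M)
  let J := Ring.jacobson A
  let N := J • (⊤ : Submodule A M)
  have h : Module.IsTorsionBySet A (M ⧸ N) J := by
    rw [Module.isTorsionBySet_quotient_iff]
    exact fun m i hi ↦ Submodule.smul_mem_smul hi trivial
  let _ := h.module
  have : IsSemisimpleModule A (M ⧸ N) :=
    (h.semilinearMap.isSemisimpleModule_iff_of_bijective Function.bijective_id).2
      inferInstance
  exact IsSemisimpleModule.jacobson_eq_bot A _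

variable (A M) in
lemma radPow_succ [IsArtinianRing A] (n : ℕ) :
    radPow A M (n + 1) = Ring.jacobson A • radPow A M n := by
  change radOf (radPow A M n) = _
  rw [radOf, moduleRad_eq_smul_top, Submodule.map_smul'', Submodule.map_top,
    Submodule.range_subtype]

lemma radPow_one : radPow A M 1 = moduleRad A M := by
  change Submodule.map (⊤ : Submodule A M).subtype (moduleRad A (⊤ : Submodule A M)) = _
  exact Module.map_jacobson_of_bijective (f := (⊤ : Submodule A M).subtype)
    (Submodule.topEquiv (R := A) (M := M)).bijective

lemma radPow_succ_le (n : ℕ) : radPow A M (n + 1) ≤ radPow A M n :=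
  Submodule.map_subtype_le _ _

lemma radPow_antitone : Antitone (radPow A M) :=
  antitone_nat_of_succ_le radPow_succ_le

lemma radPow_succ_lt [IsArtinianRing A] [Module.Finite A M] {n : ℕ} (h : radPow A M n ≠ ⊥) :
    radPow A M (n + 1) < radPow A M n := by
  rw [radPow_succ]
  exact Submodule.FG.jacobson_smul_lt h (IsNoetherian.noetherian _)

variable (A M) in
lemma exists_radPow_eq_bot [IsArtinianRing A] [Module.Finite A M] :
    ∃ n, radPow A M n = ⊥ := by
  by_contra! h
  exact not_strictAnti_of_wellFoundedLT (radPow A M) (strictAnti_nat_of_succ_lt fun n =>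
    radPow_succ_lt (h n))

lemma isUniserialModule_quotient_iff {K : Submodule A M} :
    IsUniserialModule A (M ⧸ K) ↔ ∀ N P : Submodule A M, K ≤ N → K ≤ P → N ≤ P ∨ P ≤ N := by
  constructor
  · intro h N P hN hP
    refine (h (N.map K.mkQ) (P.map K.mkQ)).imp (fun h => ?_) fun h => ?_
    all_goals
      have := Submodule.comap_mono (f := K.mkQ) h
      rwa [Submodule.comap_map_mkQ, Submodule.comap_map_mkQ, sup_eq_right.mpr hN,
        sup_eq_right.mpr hP] at this
  · intro h N P
    refine (h (N.comap K.mkQ) (P.comap K.mkQ) (Submodule.le_comap_mkQ _ _)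
      (Submodule.le_comap_mkQ _ _)).imp (fun h => ?_) fun h => ?_
    all_goals exact (Submodule.comap_le_comap_iff_of_surjective K.mkQ_surjective).mp h

lemma isUniserialModule_quotient_mono {K K' : Submodule A M} (hK : K ≤ K')
    (h : IsUniserialModule A (M ⧸ K)) : IsUniserialModule A (M ⧸ K') := by
  rw [isUniserialModule_quotient_iff] at h ⊢
  exact fun N P hN hP => h N P (hK.trans hN) (hK.trans hP)

lemma isUniserialModule_quotient_bot_iff :
    IsUniserialModule A (M ⧸ (⊥ : Submodule A M)) ↔ IsUniserialModule A M := by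
  rw [isUniserialModule_quotient_iff]
  simp [IsUniserialModule]

lemma eq_of_isCoatom_of_uniserial_top (h : IsUniserialModule A (M ⧸ moduleRad A M))
    {Z Z' : Submodule A M} (hZ : IsCoatom Z) (hZ' : IsCoatom Z') : Z = Z' := by
  rw [isUniserialModule_quotient_iff] at h
  rcases h Z Z' (sInf_le hZ) (sInf_le hZ') with h | h
  · exact ((hZ.le_iff_eq hZ'.1).mp h).symm
  · exact (hZ'.le_iff_eq hZ.1).mp h

lemma eq_top_of_uniserial_top [Module.Finite A M]
    (h : IsUniserialModule A (M ⧸ moduleRad A M)) {S : Submodule A M}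
    (hS : ¬ S ≤ moduleRad A M) : S = ⊤ := by
  by_contra hne
  obtain ⟨Z, hZ, hSZ⟩ := (eq_top_or_exists_le_coatom S).resolve_left hne
  exact hS (le_sInf fun Z' hZ' => eq_of_isCoatom_of_uniserial_top h hZ hZ' ▸ hSZ)

lemma isLocalModule_of_uniserial_top [Module.Finite A M] [Nontrivial M]
    (h : IsUniserialModule A (M ⧸ moduleRad A M)) : IsLocalModule A M := by
  obtain ⟨Z, hZ⟩ := IsCoatomic.exists_coatom (α := Submodule A M)
  exact ⟨Z, hZ, fun Z' hZ' => eq_of_isCoatom_of_uniserial_top h hZ' hZ⟩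

lemma IsLocalModule.uniserial_top (h : IsLocalModule A M) :
    IsUniserialModule A (M ⧸ moduleRad A M) := by
  obtain ⟨Z, hZ, huniq⟩ := h
  have : moduleRad A M = Z := le_antisymm (sInf_le hZ) (le_sInf fun Z' hZ' => (huniq Z' hZ').ge)
  rw [isUniserialModule_quotient_iff, this]
  intro N P hN hP
  rcases hZ.le_iff.mp hN with rfl | rfl
  · exact Or.inr le_top
  · exact Or.inl hP

section Artinian

variable [IsArtinianRing A] [Module.Finite A M]

lemma eq_radPow_of_not_le {k i : ℕ} (hU : IsUniserialModule A (M ⧸ radPow A M k)) (hik : i < k)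
    {S : Submodule A M} (hS : S ≤ radPow A M i) (hS' : ¬ S ≤ radPow A M (i + 1)) :
    S = radPow A M i := by
  rw [isUniserialModule_quotient_iff] at hU
  have hk : radPow A M k ≤ radPow A M (i + 1) := radPow_antitone hik
  have htop : S.submoduleOf (radPow A M i) = ⊤ := by
    apply eq_top_of_uniserial_top
    · rw [isUniserialModule_quotient_iff]
      intro N P hN hP
      refine (hU _ _ (hk.trans (Submodule.map_mono hN)) (hk.trans (Submodule.map_mono hP))).imp
        ?_ ?_
      all_goals exact (Submodule.map_le_map_iff_of_injective (Submodule.subtype_injective _) _ _).mp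
    · intro h
      refine hS' (le_trans ?_ (Submodule.map_mono (f := (radPow A M i).subtype) h))
      rw [Submodule.submoduleOf, Submodule.map_comap_subtype]
      exact le_inf hS le_rfl
  exact le_antisymm hS (Submodule.submoduleOf_eq_top.mp htop)

lemma exists_eq_radPow_of_not_le {k : ℕ} (hU : IsUniserialModule A (M ⧸ radPow A M k))
    {S : Submodule A M} (hS : ¬ S ≤ radPow A M k) : ∃ i < k, S = radPow A M i := by
  classical
  have hex : ∃ i, ¬ S ≤ radPow A M i := ⟨k, hS⟩
  have h0 : Nat.find hex ≠ 0 := fun h => Nat.find_spec hex (h ▸ le_top)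
  obtain ⟨i, hi⟩ := Nat.exists_eq_succ_of_ne_zero h0
  have hik : i < k := by
    have := Nat.find_min' hex hS
    omega
  have hspec := Nat.find_spec hex
  rw [hi] at hspec
  exact ⟨i, hik, eq_radPow_of_not_le hU hik
    (not_not.mp (Nat.find_min hex (m := i) (by omega))) hspec⟩

lemma exists_sup_eq_radPow {k : ℕ} (hU : IsUniserialModule A (M ⧸ radPow A M k))
    (hU' : ¬ IsUniserialModule A (M ⧸ radPow A M (k + 1))) :
    ∃ S T : Submodule A M, radPow A M (k + 1) ≤ T ∧
      S < radPow A M k ∧ T < radPow A M k ∧ S ⊔ T = radPow A M k ∧ S ≠ ⊥ := by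
  rw [isUniserialModule_quotient_iff] at hU'
  push Not at hU'
  obtain ⟨P, Q, hP, hQ, hPQ, hQP⟩ := hU'
  have key : ∀ P Q : Submodule A M, ¬ P ≤ Q → ¬ Q ≤ P → P ≤ radPow A M k := by
    intro P Q hPQ hQP
    by_contra h
    obtain ⟨i, hik, rfl⟩ := exists_eq_radPow_of_not_le hU h
    by_cases hQ : Q ≤ radPow A M k
    · exact hQP (hQ.trans (radPow_antitone hik.le))
    · obtain ⟨j, hjk, rfl⟩ := exists_eq_radPow_of_not_le hU hQ
      rcases le_total i j with h | h
      · exact hQP (radPow_antitone h)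
      · exact hPQ (radPow_antitone h)
  have hPk := key P Q hPQ hQP
  have hQk := key Q P hQP hPQ
  let W := radPow A M k
  have : IsSemisimpleModule A (W ⧸ moduleRad A W) := isSemisimpleModule_quotient_moduleRad
  obtain ⟨C, hC⟩ := exists_isCompl ((P.submoduleOf W).map (moduleRad A W).mkQ)
  have hPW : moduleRad A W ≤ P.submoduleOf W := fun x hx => hP ⟨x, hx, rfl⟩
  have hsup : P.submoduleOf W ⊔ C.comap (moduleRad A W).mkQ = ⊤ := by
    have := congrArg (Submodule.comap (moduleRad A W).mkQ) hC.sup_eq_top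
    rw [← Submodule.map_comap_eq_of_surjective (moduleRad A W).mkQ_surjective C,
      ← Submodule.map_sup, Submodule.comap_map_mkQ, Submodule.comap_top] at this
    rwa [sup_eq_right.mpr (hPW.trans le_sup_left)] at this
  have hT : (C.comap (moduleRad A W).mkQ).map W.subtype ≤ W := Submodule.map_subtype_le _ _
  have hPmap : (P.submoduleOf W).map W.subtype = P := by
    rw [Submodule.submoduleOf, Submodule.map_comap_subtype, inf_eq_right.mpr hPk]
  refine ⟨P, (C.comap (moduleRad A W).mkQ).map W.subtype,
    Submodule.map_mono (Submodule.le_comap_mkQ _ _), lt_of_le_of_ne hPk ?_,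
    lt_of_le_of_ne hT ?_, ?_, ?_⟩
  · rintro rfl
    exact hQP hQk
  · intro h
    have h1 : C.comap (moduleRad A W).mkQ = ⊤ := by
      apply Submodule.map_injective_of_injective W.subtype_injective
      rw [h, Submodule.map_top, Submodule.range_subtype]
    have h2 : C = ⊤ := by
      rw [← Submodule.map_comap_eq_of_surjective (moduleRad A W).mkQ_surjective C, h1,
        Submodule.map_top, Submodule.range_mkQ]
    have h3 := eq_bot_of_isCompl_top (h2 ▸ hC)
    have h4 : P.submoduleOf W ≤ moduleRad A W := by
      rw [← Submodule.ker_mkQ (moduleRad A W)]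
      exact LinearMap.le_ker_iff_map.mpr h3
    refine hPQ (le_trans ?_ hQ)
    rw [← hPmap]
    exact Submodule.map_mono h4
  · have := congrArg (Submodule.map W.subtype) hsup
    rwa [Submodule.map_sup, hPmap, Submodule.map_top, Submodule.range_subtype] at this
  · rintro rfl
    exact hPQ bot_le

end Artinian

end RadicalSeries

section PairModule

variable {A : Type v} [Ring A] {M : Type w} [AddCommGroup M] [Module A M]

/-- The image in `M/S × M/T` of the pairs whose entries agree modulo `rad^m(M)`. -/
def pairModule (m : ℕ) (S T : Submodule A M) : Submodule A ((M ⧸ S) × (M ⧸ T)) :=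
  ((radPow A M m).comap (LinearMap.fst A M M - LinearMap.snd A M M)).map (S.mkQ.prodMap T.mkQ)

lemma mem_pairModule {m : ℕ} {S T : Submodule A M} {x : (M ⧸ S) × (M ⧸ T)} :
    x ∈ pairModule m S T ↔ ∃ a b, a - b ∈ radPow A M m ∧ (S.mkQ a, T.mkQ b) = x := by
  simp [pairModule]

lemma mk_mem_pairModule {m : ℕ} {S T : Submodule A M} {a b : M} (h : a - b ∈ radPow A M m) :
    (S.mkQ a, T.mkQ b) ∈ pairModule m S T :=
  mem_pairModule.mpr ⟨a, b, h, rfl⟩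

lemma exists_smul_eq_and_mem_radPow [IsArtinianRing A] {a r : M} {b : ℕ}
    (ha : Submodule.span A {a} = ⊤) (hr : r ∈ radPow A M b) (i : ℕ) :
    ∀ s ∈ radPow A M i, ∃ j : A, j • a = s ∧ j • r ∈ radPow A M (b + i) := by
  induction i with
  | zero =>
    intro s _
    obtain ⟨j, hj⟩ := Submodule.mem_span_singleton.mp (ha ▸ Submodule.mem_top : s ∈ _)
    exact ⟨j, hj, Submodule.smul_mem _ _ hr⟩
  | succ i ih =>
    intro s hs
    rw [radPow_succ] at hs
    rw [← add_assoc, radPow_succ]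
    induction hs using Submodule.smul_induction_on' with
    | smul x hx n hn =>
      obtain ⟨j, hj, hj'⟩ := ih n hn
      exact ⟨x * j, by rw [mul_smul, hj], by rw [mul_smul]; exact Submodule.smul_mem_smul hx hj'⟩
    | add s _ s' _ h h' =>
      obtain ⟨j, hj, hjr⟩ := h
      obtain ⟨j', hj', hjr'⟩ := h'
      exact ⟨j + j', by rw [add_smul, hj, hj'], by rw [add_smul]; exact add_mem hjr hjr'⟩

lemma Submodule.prod_lt_prod_left {M' : Type*} [AddCommGroup M'] [Module A M']
    {N N' : Submodule A M} (P : Submodule A M') (h : N < N') : N.prod P < N'.prod P :=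
  ⟨Submodule.prod_mono h.le le_rfl, fun h' => h.not_ge fun x hx =>
    (h' (x := (x, 0)) ⟨hx, P.zero_mem⟩).1⟩

lemma Submodule.prod_lt_prod_right {M' : Type*} [AddCommGroup M'] [Module A M']
    (N : Submodule A M) {P P' : Submodule A M'} (h : P < P') : N.prod P < N.prod P' :=
  ⟨Submodule.prod_mono le_rfl h.le, fun h' => h.not_ge fun x hx =>
    (h' (x := (0, x)) ⟨N.zero_mem, hx⟩).2⟩

variable [IsArtinianRing A] [Module.Finite A M] {m : ℕ} {S T : Submodule A M}

lemma mem_radPow_of_jacobson_smul_le (hU : IsUniserialModule A (M ⧸ radPow A M m))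
    (hS : S < radPow A M m) {c : M} (hc : Ring.jacobson A • Submodule.span A {c} ≤ S) :
    c ∈ radPow A M m := by
  by_contra h
  obtain ⟨i, hi, hci⟩ := exists_eq_radPow_of_not_le hU
    (fun h' => h (h' (Submodule.mem_span_singleton_self c)))
  rw [hci, ← radPow_succ] at hc
  exact hS.not_ge ((radPow_antitone hi).trans hc)

lemma eq_bot_of_disjoint_of_pair_mem (hm : 1 ≤ m)
    (hU : IsUniserialModule A (M ⧸ radPow A M (m + 1)))
    (hT : radPow A M (m + 2) ≤ T) (hS' : S < radPow A M (m + 1))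
    (hT' : T < radPow A M (m + 1)) (hST : S ⊔ T = radPow A M (m + 1))
    {N P : Submodule A ((M ⧸ S) × (M ⧸ T))} (hP : P ≤ pairModule m S T) (hd : Disjoint N P)
    {a b : M} (ha : a ∉ radPow A M 1) (hab : a - b ∈ radPow A M m)
    (hN : (S.mkQ a, T.mkQ b) ∈ N) : P = ⊥ := by
  have hspan : Submodule.span A {a} = ⊤ :=
    eq_radPow_of_not_le hU m.succ_pos le_top
      (fun h => ha (h (Submodule.mem_span_singleton_self a)))
  have hdiag : ∀ s ∈ radPow A M (m + 1), (S.mkQ s, T.mkQ s) ∈ N := by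
    intro s hs
    obtain ⟨j, hj, hj'⟩ := exists_smul_eq_and_mem_radPow hspan hab _ s hs
    have hr : j • (a - b) ∈ T := hT (radPow_antitone (by omega) hj')
    rw [smul_sub, hj] at hr
    have hb : T.mkQ s = T.mkQ (j • b) := (Submodule.Quotient.eq T).mpr hr
    have := N.smul_mem j hN
    rwa [Prod.smul_mk, ← map_smul, ← map_smul, hj, ← hb] at this
  have hN' : ∀ c ∈ radPow A M (m + 1), ∀ d ∈ radPow A M (m + 1), (S.mkQ c, T.mkQ d) ∈ N := by
    intro c hc d hd
    have h0 : c - d ∈ S ⊔ T := hST ▸ sub_mem hc hd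
    obtain ⟨s, hs, t, ht, hst⟩ := Submodule.mem_sup.mp h0
    have := hdiag (d + t) (add_mem hd (hT'.le ht))
    have hct : S.mkQ c = S.mkQ (d + t) :=
      (Submodule.Quotient.eq S).mpr (by rwa [← sub_sub, ← hst, add_sub_cancel_right])
    have hdt : T.mkQ d = T.mkQ (d + t) :=
      (Submodule.Quotient.eq T).mpr (by simpa using ht)
    rwa [hct, hdt]
  by_contra hne
  obtain ⟨L, hL, hLP⟩ := (eq_bot_or_exists_atom_le P).resolve_left hne
  have hJL : Ring.jacobson A • L = ⊥ :=
    (hL.lt_iff).mp (Submodule.FG.jacobson_smul_lt hL.1 (IsNoetherian.noetherian _))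
  obtain ⟨p, hpL, hp⟩ := Submodule.exists_mem_ne_zero_of_ne_bot hL.1
  obtain ⟨c, d, -, rfl⟩ := mem_pairModule.mp (hP (hLP hpL))
  have hJ : ∀ x ∈ Ring.jacobson A, ∀ r : A, x • r • c ∈ S ∧ x • r • d ∈ T := by
    intro x hx r
    have : x • r • (S.mkQ c, T.mkQ d) = 0 := by
      rw [← Submodule.mem_bot A, ← hJL]
      exact Submodule.smul_mem_smul hx (L.smul_mem r hpL)
    rw [Prod.smul_mk, Prod.smul_mk, ← map_smul, ← map_smul, ← map_smul, ← map_smul] at this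
    exact ⟨(Submodule.Quotient.mk_eq_zero S).mp (congrArg Prod.fst this),
      (Submodule.Quotient.mk_eq_zero T).mp (congrArg Prod.snd this)⟩
  have hc : c ∈ radPow A M (m + 1) := mem_radPow_of_jacobson_smul_le hU hS' (by
    rw [Submodule.smul_le]
    intro x hx n hn
    obtain ⟨r, rfl⟩ := Submodule.mem_span_singleton.mp hn
    exact (hJ x hx r).1)
  have hd' : d ∈ radPow A M (m + 1) := mem_radPow_of_jacobson_smul_le hU hT' (by
    rw [Submodule.smul_le]
    intro x hx n hn
    obtain ⟨r, rfl⟩ := Submodule.mem_span_singleton.mp hn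
    exact (hJ x hx r).2)
  exact hp (Submodule.disjoint_def.mp hd _ (hN' c hc d hd') (hLP hpL))

lemma radPow_one_lt_top (hS' : S < radPow A M (m + 1)) : radPow A M 1 < ⊤ :=
  radPow_succ_lt (n := 0) (fun h => (bot_le.trans_lt hS').not_ge (h ▸ le_top))

lemma isIndecModule_pairModule (hm : 1 ≤ m)
    (hU : IsUniserialModule A (M ⧸ radPow A M (m + 1)))
    (hT : radPow A M (m + 2) ≤ T) (hS' : S < radPow A M (m + 1))
    (hT' : T < radPow A M (m + 1)) (hST : S ⊔ T = radPow A M (m + 1)) :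
    IsIndecModule A (pairModule m S T) := by
  obtain ⟨u, -, hu⟩ := SetLike.exists_of_lt (radPow_one_lt_top hS')
  have hmem : ∀ x : M, (S.mkQ x, T.mkQ x) ∈ pairModule m S T := fun x =>
    mk_mem_pairModule (by rw [sub_self]; exact zero_mem _)
  refine ⟨⟨⟨_, hmem u⟩, 0, fun h => hu ?_⟩, fun N P hNP => ?_⟩
  · have h1 : S.mkQ u = 0 := congrArg (fun z => z.1.1) h
    exact radPow_antitone (by omega) (hS'.le ((Submodule.Quotient.mk_eq_zero S).mp h1))
  have key : ∀ N P : Submodule A (pairModule m S T), IsCompl N P →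
      ∀ x ∈ N, ∀ a b : M, (S.mkQ a, T.mkQ b) = x.1 → a - b ∈ radPow A M m →
        a ∉ radPow A M 1 → P = ⊥ := by
    intro N P hNP x hx a b hxab hab ha
    refine Submodule.map_injective_of_injective (pairModule m S T).subtype_injective
      (Eq.trans ?_ (Submodule.map_bot _).symm)
    refine eq_bot_of_disjoint_of_pair_mem hm hU hT hS' hT' hST
      (N := N.map (pairModule m S T).subtype) (Submodule.map_subtype_le _ _)
      ?_ ha hab (hxab ▸ Submodule.mem_map_of_mem hx)
    exact Submodule.disjoint_map (pairModule m S T).subtype_injective hNP.disjoint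
  obtain ⟨x, hx, y, hy, hxy⟩ := Submodule.mem_sup.mp
    (hNP.sup_eq_top ▸ Submodule.mem_top : (⟨_, hmem u⟩ : pairModule m S T) ∈ N ⊔ P)
  obtain ⟨a, b, hab, hx'⟩ := mem_pairModule.mp x.2
  obtain ⟨c, d, hcd, hy'⟩ := mem_pairModule.mp y.2
  by_cases ha : a ∈ radPow A M 1
  · refine Or.inl (key P N hNP.symm y hy c d hy' hcd fun hc => hu ?_)
    have h1 : S.mkQ (a + c) = S.mkQ u := by
      rw [map_add]
      have := congrArg (fun z => z.1.1) hxy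
      simpa [← hx', ← hy'] using this
    have h2 : u - (a + c) ∈ radPow A M 1 :=
      radPow_antitone (by omega) (hS'.le ((Submodule.Quotient.eq S).mp h1.symm))
    simpa using add_mem h2 (add_mem ha hc)
  · exact Or.inr (key N P hNP x hx a b hx' hab ha)

lemma not_uniserial_top_pairModule (hS' : S < radPow A M (m + 1))
    (hT' : T < radPow A M (m + 1)) :
    ¬ IsUniserialModule A (pairModule m S T ⧸ moduleRad A (pairModule m S T)) := by
  intro h
  obtain ⟨u, -, hu⟩ := SetLike.exists_of_lt (radPow_one_lt_top hS')
  obtain ⟨v, hv, hv'⟩ := SetLike.exists_of_lt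
    (radPow_succ_lt (A := A) (M := M) (n := m) fun h => (bot_le.trans_lt hS').not_ge
      (h ▸ radPow_succ_le m))
  let δ : M →ₗ[A] pairModule m S T := (S.mkQ.prod T.mkQ).codRestrict _ fun x =>
    mk_mem_pairModule (by rw [sub_self]; exact zero_mem _)
  by_cases hδ : LinearMap.range δ ≤ moduleRad A (pairModule m S T)
  · have h1 : δ u ∈ moduleRad A (pairModule m S T) := hδ ⟨u, rfl⟩
    have h2 : S.mkQ u ∈ moduleRad A (M ⧸ S) :=
      Module.le_comap_jacobson (LinearMap.fst A _ _ ∘ₗ (pairModule m S T).subtype) h1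
    rw [moduleRad_eq_smul_top, ← Submodule.range_mkQ, ← Submodule.map_top,
      ← Submodule.map_smul'', ← moduleRad_eq_smul_top, ← radPow_one] at h2
    obtain ⟨w, hw, hwu⟩ := h2
    have h3 : u - w ∈ radPow A M 1 :=
      radPow_antitone (by omega) (hS'.le ((Submodule.Quotient.eq S).mp hwu.symm))
    exact hu (by simpa using add_mem h3 hw)
  · have h1 := eq_top_of_uniserial_top h hδ
    have hv0 : (S.mkQ v, T.mkQ 0) ∈ pairModule m S T :=
      mk_mem_pairModule (by rwa [sub_zero])
    obtain ⟨w, hw⟩ : (⟨_, hv0⟩ : pairModule m S T) ∈ LinearMap.range δ := h1 ▸ Submodule.mem_top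
    have hwS : v - w ∈ S := (Submodule.Quotient.eq S).mp (congrArg (fun z => z.1.1) hw).symm
    have hwT : w ∈ T := (Submodule.Quotient.mk_eq_zero T).mp
      ((congrArg (fun z => z.1.2) hw).trans (map_zero _))
    exact hv' (by simpa using add_mem (hS'.le hwS) (hT'.le hwT))

lemma five_le_moduleLength_pairModule (hm : 1 ≤ m) (hS' : S < radPow A M (m + 1))
    (hT' : T < radPow A M (m + 1)) : 5 ≤ moduleLength A (pairModule m S T) := by
  let Y := (radPow A M m).comap (LinearMap.fst A M M - LinearMap.snd A M M)
  let φ := S.mkQ.prodMap T.mkQ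
  let F : Submodule A (M × M) → Submodule A (pairModule m S T) :=
    fun Q => (Q.map φ).submoduleOf (pairModule m S T)
  have hker : LinearMap.ker φ = S.prod T := by
    ext ⟨x, y⟩
    simp [φ]
  have hF : ∀ Q Q' : Submodule A (M × M), S.prod T ≤ Q → Q' ≤ Y → Q < Q' → F Q < F Q' := by
    intro Q Q' hQ hQ' h
    refine ⟨Submodule.comap_mono (Submodule.map_mono h.le), fun h' => h.not_ge fun x hx => ?_⟩
    have h1 : φ x ∈ Q.map φ :=
      h' (x := ⟨φ x, Submodule.mem_map_of_mem (hQ' hx)⟩) (Submodule.mem_map_of_mem hx)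
    rw [← Submodule.mem_comap, Submodule.comap_map_eq, hker, sup_eq_left.mpr hQ] at h1
    exact h1
  have hk : radPow A M (m + 1) < radPow A M m :=
    radPow_succ_lt fun h => (bot_le.trans_lt hS').not_ge (h ▸ radPow_succ_le m)
  have hmY : (radPow A M m).prod (radPow A M m) < Y := by
    obtain ⟨u, -, hu⟩ := SetLike.exists_of_lt (radPow_one_lt_top hS')
    refine ⟨fun x hx => sub_mem hx.1 hx.2, fun h => hu (radPow_antitone hm ?_)⟩
    have : (u, u) ∈ Y := by simp [Y]
    exact (h this).1
  have h0 := Submodule.prod_lt_prod_right S hT'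
  have h1 := Submodule.prod_lt_prod_right S hk
  have h2 := Submodule.prod_lt_prod_left (radPow A M m) hS'
  have h3 := Submodule.prod_lt_prod_left (radPow A M m) hk
  have hF1 := hF _ _ le_rfl (h1.trans (h2.trans (h3.trans hmY))).le h0
  have hF2 := hF _ _ h0.le (h2.trans (h3.trans hmY)).le h1
  have hF3 := hF _ _ (h0.trans h1).le (h3.trans hmY).le h2
  have hF4 := hF _ _ (h0.trans (h1.trans h2)).le hmY.le h3
  have hF5 := hF _ _ (h0.trans (h1.trans (h2.trans h3))).le le_rfl hmY
  let c : LTSeries (Submodule A (pairModule m S T)) :=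
    { length := 5
      toFun := ![F (S.prod T), F (S.prod (radPow A M (m + 1))), F (S.prod (radPow A M m)),
        F ((radPow A M (m + 1)).prod (radPow A M m)), F ((radPow A M m).prod (radPow A M m)), F Y]
      step := by
        intro i
        fin_cases i
        exacts [hF1, hF2, hF3, hF4, hF5] }
  exact Order.LTSeries.length_le_krullDim c

end PairModule
section FactorSerial

variable {A : Type v} [Ring A] {M : Type w} [AddCommGroup M] [Module A M]

lemma exists_moduleLength_eq [IsArtinianRing A] [Module.Finite A M] :
    ∃ l : ℕ, moduleLength A M = l := by
  have hM : IsFiniteLength A M := ((IsArtinianRing.tfae A M).out 0 3).mp ‹Module.Finite A M›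
  have := Module.length_ne_top_iff.mpr hM
  obtain ⟨l, hl⟩ := ENat.ne_top_iff_exists.mp this
  exact ⟨l, by rw [moduleLength, ← Module.coe_length, ← hl]; rfl⟩

lemma IsUniserialModule.uniserial_top (h : IsUniserialModule A M) :
    IsUniserialModule A (M ⧸ moduleRad A M) :=
  isUniserialModule_quotient_mono bot_le (isUniserialModule_quotient_bot_iff.mpr h)

lemma IsFactorSerial.uniserial_top {n : ℕ} (h : IsFactorSerial A M n)
    (hn : (n : WithBot ℕ∞) < moduleLength A M) : IsUniserialModule A (M ⧸ moduleRad A M) := by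
  rcases h with ⟨-, h⟩ | ⟨-, -, l, hl, -, h, -⟩
  · exact h.uniserial_top
  · rw [hl] at hn
    have hn : n < l := by exact_mod_cast hn
    rw [← radPow_one]
    exact isUniserialModule_quotient_mono (radPow_antitone (by omega)) h

lemma IsNFactorSerial.exists_pairModule [IsArtinianRing A] [Module.Finite A M] {n : ℕ}
    (h : IsNFactorSerial A M n) (hn : ((n + 1 : ℕ) : WithBot ℕ∞) < moduleLength A M) :
    ∃ (m : ℕ) (S T : Submodule A M), IsIndecModule A (pairModule m S T) ∧
      5 ≤ moduleLength A (pairModule m S T) ∧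
      ¬ IsUniserialModule A (pairModule m S T ⧸ moduleRad A (pairModule m S T)) := by
  obtain ⟨-, -, l, hl, -, hU, hU'⟩ := h
  rw [hl] at hn
  have hn : n + 1 < l := by exact_mod_cast hn
  obtain ⟨m, hm⟩ : ∃ m, l - n = m + 1 := ⟨l - n - 1, by omega⟩
  rw [hm] at hU hU'
  obtain ⟨S, T, hT, hS', hT', hST, -⟩ := exists_sup_eq_radPow hU hU'
  have hm1 : 1 ≤ m := by omega
  exact ⟨m, S, T, isIndecModule_pairModule hm1 hU hT hS' hT' hST,
    five_le_moduleLength_pairModule hm1 hS' hT', not_uniserial_top_pairModule hS' hT'⟩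

/-- The first quotient `M/rad^{k+1}(M)` that is not uniserial. -/
lemma exists_quotient_radPow_not_uniserial [IsArtinianRing A] [Module.Finite A M]
    (h : ¬ IsUniserialModule A M) :
    ∃ k, IsUniserialModule A (M ⧸ radPow A M k) ∧
      ¬ IsUniserialModule A (M ⧸ radPow A M (k + 1)) := by
  classical
  have hex : ∃ k, ¬ IsUniserialModule A (M ⧸ radPow A M k) := by
    obtain ⟨k, hk⟩ := exists_radPow_eq_bot A M
    exact ⟨k, by rwa [hk, isUniserialModule_quotient_bot_iff]⟩
  have h0 : Nat.find hex ≠ 0 := fun h => Nat.find_spec hex (by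
    rw [h, isUniserialModule_quotient_iff]
    exact fun N P _ hP => Or.inl (le_top.trans hP))
  obtain ⟨k, hk⟩ := Nat.exists_eq_succ_of_ne_zero h0
  have hspec := Nat.find_spec hex
  rw [hk] at hspec
  exact ⟨k, not_not.mp (Nat.find_min hex (m := k) (by omega)), hspec⟩

lemma add_two_le_moduleLength [IsArtinianRing A] [Module.Finite A M] {k : ℕ} {S : Submodule A M}
    (hS : S < radPow A M k) (hS0 : S ≠ ⊥) : ((k + 2 : ℕ) : WithBot ℕ∞) ≤ moduleLength A M := by
  have hlt : ∀ i ≤ k, radPow A M (i + 1) < radPow A M i := fun i hi =>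
    radPow_succ_lt fun h => (bot_le.trans_lt hS).not_ge (h ▸ radPow_antitone hi)
  let c : LTSeries (Submodule A M) :=
    { length := k
      toFun := fun i => radPow A M (k - i)
      step := fun i => by
        have := hlt (k - (i + 1)) (by omega)
        rwa [show k - ((i : ℕ) + 1) + 1 = k - i by omega] at this }
  let c' := (c.cons S (by change S < radPow A M (k - 0); exact hS)).cons ⊥
    (by change ⊥ < S; exact bot_lt_iff_ne_bot.mpr hS0)
  have hc : c'.length = k + 2 := by simp [c', c]
  exact hc ▸ Order.LTSeries.length_le_krullDim c'

lemma exists_isNFactorSerial [IsArtinianRing A] [Module.Finite A M] {l : ℕ}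
    (hl : moduleLength A M = l) (h : ¬ IsUniserialModule A M) :
    ∃ n, n ≤ l ∧ IsNFactorSerial A M n ∧
      (IsUniserialModule A (M ⧸ moduleRad A M) → n < l) := by
  obtain ⟨k, hk, hk'⟩ := exists_quotient_radPow_not_uniserial h
  obtain ⟨S, T, -, hS, -, -, hS0⟩ := exists_sup_eq_radPow hk hk'
  have hkl := add_two_le_moduleLength hS hS0
  rw [hl] at hkl
  have hkl : k + 2 ≤ l := by exact_mod_cast hkl
  refine ⟨l - k, Nat.sub_le _ _, ⟨by omega, h, l, hl, Nat.sub_le _ _, ?_, ?_⟩, fun hU => ?_⟩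
  · rwa [Nat.sub_sub_self (by omega)]
  · rwa [Nat.sub_sub_self (by omega)]
  · have : k ≠ 0 := by
      rintro rfl
      rw [zero_add, radPow_one] at hk'
      exact hk' hU
    omega

end FactorSerial

section IndecomposableProjectives

variable {Λ : Type u} [Ring Λ]

variable (Λ) in
lemma moduleFinite_mulOpposite : Module.Finite Λᵐᵒᵖ Λ :=
  Module.Finite.of_surjective (LinearMap.toSpanSingleton Λᵐᵒᵖ Λ 1) fun a =>
    ⟨MulOpposite.op a, one_mul a⟩

/-- The right ideal of all values at `x` of the linear forms on a left module. -/
def evalRange {P : Type u} [AddCommGroup P] [Module Λ P] (x : P) : Submodule Λᵐᵒᵖ Λ where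
  carrier := {a | ∃ h : P →ₗ[Λ] Λ, h x = a}
  add_mem' := by
    rintro _ _ ⟨h, rfl⟩ ⟨h', rfl⟩
    exact ⟨h + h', rfl⟩
  zero_mem' := ⟨0, rfl⟩
  smul_mem' := by
    rintro c _ ⟨h, rfl⟩
    exact ⟨c • h, rfl⟩

/-- The right submodule of `Λ × Λ` of all pairs `(h x, -h y)` with `h` a linear form. -/
def evalPairRange {P : Type u} [AddCommGroup P] [Module Λ P] (x y : P) :
    Submodule Λᵐᵒᵖ (Λ × Λ) where
  carrier := {a | ∃ h : P →ₗ[Λ] Λ, (h x, -h y) = a}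
  add_mem' := by
    rintro _ _ ⟨h, rfl⟩ ⟨h', rfl⟩
    exact ⟨h + h', by simp [add_comm]⟩
  zero_mem' := ⟨0, by simp⟩
  smul_mem' := by
    rintro c _ ⟨h, rfl⟩
    exact ⟨c • h, by simp⟩

section Endomorphisms

variable {P : Type u} [AddCommGroup P] [Module Λ P]

lemma exists_end_of_forall_dual [Module.Finite Λ P] [Module.Projective Λ P] {x y x' y' : P}
    (H : ∀ h : P →ₗ[Λ] Λ, ∃ h' : P →ₗ[Λ] Λ, h' x = h x' ∧ h' y = h y') :
    ∃ σ : Module.End Λ P, σ x = x' ∧ σ y = y' := by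
  obtain ⟨n, f, hf⟩ := Module.Finite.exists_fin' Λ P
  obtain ⟨s, hs⟩ := Module.projective_lifting_property f LinearMap.id hf
  choose t ht using fun i => H (LinearMap.proj i ∘ₗ s)
  refine ⟨f ∘ₗ LinearMap.pi t, ?_, ?_⟩
  · have : (LinearMap.pi t) x = s x' := by
      ext i; exact (ht i).1
    rw [LinearMap.comp_apply, this]
    exact LinearMap.congr_fun hs x'
  · have : (LinearMap.pi t) y = s y' := by
      ext i; exact (ht i).2
    rw [LinearMap.comp_apply, this]
    exact LinearMap.congr_fun hs y'

lemma exists_end_of_evalRange_le [Module.Finite Λ P] [Module.Projective Λ P] {y y' : P}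
    (H : evalRange (Λ := Λ) y' ≤ evalRange y) : ∃ σ : Module.End Λ P, σ y = y' := by
  obtain ⟨σ, h, -⟩ := exists_end_of_forall_dual (Λ := Λ) (x := y) (y := y) (x' := y') (y' := y')
    fun h => by
      obtain ⟨h', e⟩ := H ⟨h, rfl⟩
      exact ⟨h', e, e⟩
  exact ⟨σ, h⟩

lemma evalRange_apply_le (σ : Module.End Λ P) (y : P) :
    evalRange (Λ := Λ) (σ y) ≤ evalRange y := by
  rintro _ ⟨h, rfl⟩
  exact ⟨h ∘ₗ σ, rfl⟩

lemma IsIndecModule.bijective_or_isNilpotent [IsArtinian Λ P] [IsNoetherian Λ P]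
    (hP : IsIndecModule Λ P) (σ : Module.End Λ P) :
    Function.Bijective σ ∨ IsNilpotent σ := by
  obtain ⟨n, hn, hpos⟩ := ((LinearMap.eventually_isCompl_ker_pow_range_pow σ).and
    (Filter.eventually_gt_atTop 0)).exists
  rcases hP.2 _ _ hn with h | h
  · left
    have hinj : Function.Injective σ := by
      rw [← LinearMap.ker_eq_bot, eq_bot_iff, ← h]
      intro z hz
      obtain ⟨m, rfl⟩ := Nat.exists_eq_succ_of_ne_zero hpos.ne'
      rw [LinearMap.mem_ker, pow_succ, Module.End.mul_apply, LinearMap.mem_ker.mp hz, map_zero]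
    exact IsArtinian.bijective_of_injective_endomorphism σ hinj
  · right
    exact ⟨n, LinearMap.range_eq_bot.mp h⟩

end Endomorphisms

/-- Right ideals contained in `{a | f * a = a}` are totally ordered. -/
def IsUniserialLeftFix (f : Λ) : Prop :=
  ∀ I I' : Submodule Λᵐᵒᵖ Λ, (∀ a ∈ I, f * a = a) → (∀ a ∈ I', f * a = a) → I ≤ I' ∨ I' ≤ I

lemma isIndecModule_quotient_of_maximal {A : Type v} [Ring A] {M : Type w} [AddCommGroup M]
    [Module A M] {N : Submodule A M} {z : M} (hN : Maximal (fun N' => z ∉ N') N) :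
    IsIndecModule A (M ⧸ N) := by
  have key : ∀ Q : Submodule A (M ⧸ N), Q ≠ ⊥ → N.mkQ z ∈ Q := by
    intro Q hQ
    by_contra hz
    apply hQ
    have h1 : Q.comap N.mkQ ≤ N :=
      hN.le_of_ge (y := Q.comap N.mkQ) hz (by
        intro n hn
        have : N.mkQ n = 0 := (Submodule.Quotient.mk_eq_zero N).mpr hn
        rw [Submodule.mem_comap, this]; exact Q.zero_mem)
    rw [eq_bot_iff]
    intro q hq
    obtain ⟨m, rfl⟩ := N.mkQ_surjective q
    exact (Submodule.Quotient.mk_eq_zero N).mpr (h1 hq)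
  have hz0 : N.mkQ z ≠ 0 := fun h => hN.prop ((Submodule.Quotient.mk_eq_zero N).mp h)
  refine ⟨⟨_, _, hz0⟩, fun Q Q' hc => ?_⟩
  by_contra! h
  exact hz0 (Submodule.disjoint_def.mp hc.disjoint _ (key Q h.1) (key Q' h.2))

variable (Λ) in
/-- Every finitely generated indecomposable right module is uniserial. -/
def AllIndecUniserial : Prop :=
  ∀ (M : Type u) [AddCommGroup M] [Module Λᵐᵒᵖ M] [Module.Finite Λᵐᵒᵖ M],
    IsIndecModule Λᵐᵒᵖ M → IsUniserialModule Λᵐᵒᵖ M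

section

variable {P : Type u} [AddCommGroup P] [Module Λ P]

lemma exists_notMem_evalPairRange [IsArtinian Λ P] [IsNoetherian Λ P]
    [Module.Projective Λ P] (hP : IsIndecModule Λ P) {x y : P} (hx : x ≠ 0) (hy : y ≠ 0) :
    ∃ h : P →ₗ[Λ] Λ, (h x, (0 : Λ)) ∉ evalPairRange (Λ := Λ) x y := by
  by_contra! H
  obtain ⟨σ, h1, h2⟩ := exists_end_of_forall_dual (Λ := Λ) (x := x) (y := y) (x' := x) (y' := 0)
    fun h => by
      obtain ⟨h', e⟩ := H h
      rw [Prod.mk.injEq, neg_eq_zero] at e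
      exact ⟨h', e.1, by rw [e.2, map_zero]⟩
  rcases hP.bijective_or_isNilpotent σ with hb | ⟨n, hn⟩
  · exact hy (hb.1 (by rw [h2, map_zero]))
  · have : ∀ m, (σ ^ m) x = x := fun m => by
      induction m with
      | zero => rfl
      | succ m ih => rw [pow_succ, Module.End.mul_apply, h1, ih]
    exact hx (by rw [← this n, hn]; rfl)

lemma evalRange_sub_lt {g c : Λ} {x y : P} (hgu : IsUniserialLeftFix g) (hgg : g * g = g)
    (hgy : g • y = y) {I : Submodule Λᵐᵒᵖ Λ}
    (hI : ∀ h : P →ₗ[Λ] Λ, h (y - (g * c) • x) ∈ I) (hyI : ∃ h : P →ₗ[Λ] Λ, h y ∉ I) :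
    evalRange (Λ := Λ) (y - (g * c) • x) < evalRange y := by
  obtain ⟨h0, hh0⟩ := hyI
  have hfix : g • (y - (g * c) • x) = y - (g * c) • x := by
    rw [smul_sub, hgy, smul_smul, ← mul_assoc, hgg]
  rcases hgu (evalRange (y - (g * c) • x)) (evalRange y)
    (by rintro _ ⟨h, rfl⟩; rw [← smul_eq_mul, ← map_smul, hfix])
    (by rintro _ ⟨h, rfl⟩; rw [← smul_eq_mul, ← map_smul, hgy]) with h | h
  · refine lt_of_le_not_ge h fun h' => ?_
    obtain ⟨h1, e⟩ := h' ⟨h0, rfl⟩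
    exact hh0 (e ▸ hI h1)
  · obtain ⟨h1, e⟩ := h ⟨h0, rfl⟩
    exact absurd (e ▸ hI h1) hh0

lemma AllIndecUniserial.exists_evalRange_lt [IsNoetherianRing Λᵐᵒᵖ] [IsArtinian Λ P]
    [IsNoetherian Λ P] [Module.Projective Λ P] (hU : AllIndecUniserial Λ)
    (hP : IsIndecModule Λ P) {f g : Λ} (hff : f * f = f) (hgg : g * g = g)
    (hfu : IsUniserialLeftFix f) (hgu : IsUniserialLeftFix g) {x y : P} (hx : x ≠ 0) (hy : y ≠ 0)
    (hfx : f • x = x) (hgy : g • y = y) :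
    (∃ c : Λ, evalRange (Λ := Λ) (y - (g * c) • x) < evalRange y) ∨
      ∃ c : Λ, evalRange (Λ := Λ) (x - (f * c) • y) < evalRange x := by
  obtain ⟨h0, hh0⟩ := exists_notMem_evalPairRange hP hx hy
  have hfh : ∀ h : P →ₗ[Λ] Λ, f * h x = h x := fun h => by
    rw [← smul_eq_mul, ← map_smul, hfx]
  have hgh : ∀ h : P →ₗ[Λ] Λ, g * h y = h y := fun h => by
    rw [← smul_eq_mul, ← map_smul, hgy]
  let π : (Λ × Λ) →ₗ[Λᵐᵒᵖ] (Λ × Λ) :=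
    { toFun := fun p => (f * p.1, g * p.2)
      map_add' := fun p q => by simp [mul_add]
      map_smul' := fun a p => by simp [MulOpposite.smul_eq_mul_unop, mul_assoc] }
  let K := (evalPairRange (Λ := Λ) x y).comap π
  have hzK : (h0 x, (0 : Λ)) ∉ K := fun h => hh0 (by
    have : (f * h0 x, g * (0 : Λ)) ∈ evalPairRange (Λ := Λ) x y := h
    rwa [hfh, mul_zero] at this)
  have : Module.Finite Λᵐᵒᵖ Λ := moduleFinite_mulOpposite Λ
  obtain ⟨N, hKN, hN⟩ := exists_maximal_ge_of_wellFoundedGT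
    (fun N' : Submodule Λᵐᵒᵖ (Λ × Λ) => (h0 x, (0 : Λ)) ∉ N') K hzK
  have hKpair : ∀ h : P →ₗ[Λ] Λ, (h x, -h y) ∈ N := fun h => hKN (by
    refine ⟨h, ?_⟩
    change _ = (f * h x, g * -h y)
    rw [hfh, mul_neg, hgh])
  have hKproj : ∀ a b : Λ, (a - f * a, b - g * b) ∈ N := fun a b => hKN (by
    refine ⟨0, ?_⟩
    change _ = (f * (a - f * a), g * (b - g * b))
    simp [mul_sub, ← mul_assoc, hff, hgg])
  have hu := hU ((Λ × Λ) ⧸ N) (isIndecModule_quotient_of_maximal hN)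
  rcases hu (Submodule.span _ {N.mkQ (1, 0)}) (Submodule.span _ {N.mkQ (0, 1)}) with h | h
  · left
    obtain ⟨c, hc⟩ := Submodule.mem_span_singleton.mp (h (Submodule.mem_span_singleton_self _))
    rw [← map_smul, ← sub_eq_zero, ← map_sub, Submodule.mkQ_apply,
      Submodule.Quotient.mk_eq_zero] at hc
    refine ⟨c.unop, evalRange_sub_lt (I := N.comap (LinearMap.inr _ _ _)) hgu hgg hgy ?_ ?_⟩
    · intro h
      have h1 := N.add_mem (N.sub_mem (N.smul_mem (-MulOpposite.op (h x)) hc) (hKpair h))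
        (hKproj 0 (c.unop * h x))
      rw [Submodule.mem_comap, LinearMap.inr_apply, map_sub, map_smul, smul_eq_mul, mul_assoc]
      convert h1 using 1
      ext <;> simp
      abel
    · refine ⟨h0, fun h => hN.prop ?_⟩
      have h1 := N.add_mem (hKpair h0) h
      simpa using h1
  · right
    obtain ⟨c, hc⟩ := Submodule.mem_span_singleton.mp (h (Submodule.mem_span_singleton_self _))
    rw [← map_smul, ← sub_eq_zero, ← map_sub, Submodule.mkQ_apply,
      Submodule.Quotient.mk_eq_zero] at hc
    refine ⟨c.unop, evalRange_sub_lt (I := N.comap (LinearMap.inl _ _ _)) hfu hff hfx ?_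
      ⟨h0, hN.prop⟩⟩
    intro h
    have h1 := N.add_mem (N.add_mem (N.smul_mem (-MulOpposite.op (h y)) hc) (hKpair h))
      (hKproj (c.unop * h y) 0)
    rw [Submodule.mem_comap, LinearMap.inl_apply, map_sub, map_smul, smul_eq_mul, mul_assoc]
    convert h1 using 1
    ext <;> simp
    abel

lemma exists_smul_eq_of_evalRange_sub_lt [IsArtinian Λ P] [IsNoetherian Λ P]
    [Module.Projective Λ P] (hP : IsIndecModule Λ P) {x y : P} (hy : y ≠ 0) {c : Λ}
    (hlt : evalRange (Λ := Λ) (y - c • x) < evalRange y)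
    (h : (∃ a : Λ, y - c • x = a • x) ∨ ∃ a : Λ, x = a • (y - c • x)) : ∃ a : Λ, y = a • x := by
  rcases h with ⟨a, ha⟩ | ⟨a, ha⟩
  · exact ⟨a + c, by rw [add_smul, ← ha, sub_add_cancel]⟩
  exfalso
  obtain ⟨σ, hσ⟩ := exists_end_of_evalRange_le hlt.le
  rcases hP.bijective_or_isNilpotent σ with hb | ⟨n, hn⟩
  · let e := LinearEquiv.ofBijective σ hb
    have : e.symm (y - c • x) = y := by rw [← hσ]; exact e.symm_apply_apply y
    have hle := evalRange_apply_le (e.symm : P →ₗ[Λ] P) (y - c • x)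
    rw [LinearEquiv.coe_coe, this] at hle
    exact hlt.not_ge hle
  · have hd : y = (1 + c * a) • σ y := by
      rw [hσ, add_smul, one_smul, mul_smul, ← ha, sub_add_cancel]
    have : ∀ m, y = (1 + c * a) ^ m • (σ ^ m) y := fun m => by
      induction m with
      | zero => simp
      | succ m ih =>
        conv_lhs => rw [ih, hd]
        rw [map_smul, smul_smul, ← pow_succ, ← Module.End.mul_apply, ← pow_succ]
    exact hy (by rw [this n, hn]; simp)

lemma AllIndecUniserial.exists_smul_eq [IsNoetherianRing Λᵐᵒᵖ] [IsArtinianRing Λᵐᵒᵖ]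
    [IsArtinian Λ P] [IsNoetherian Λ P] [Module.Projective Λ P] (hU : AllIndecUniserial Λ)
    (hP : IsIndecModule Λ P) {f g : Λ} (hff : f * f = f) (hgg : g * g = g)
    (hfu : IsUniserialLeftFix f) (hgu : IsUniserialLeftFix g) (x y : P)
    (hfx : f • x = x) (hgy : g • y = y) : (∃ a : Λ, y = a • x) ∨ ∃ a : Λ, x = a • y := by
  have : Module.Finite Λᵐᵒᵖ Λ := moduleFinite_mulOpposite Λ
  have : IsArtinian Λᵐᵒᵖ Λ := inferInstance
  generalize hp : (evalRange (Λ := Λ) x, evalRange (Λ := Λ) y) = p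
  induction p using WellFoundedLT.induction generalizing x y with
  | ind p ih =>
  subst hp
  by_cases hx : x = 0
  · exact Or.inr ⟨0, by simpa using hx⟩
  by_cases hy : y = 0
  · exact Or.inl ⟨0, by simpa using hy⟩
  rcases hU.exists_evalRange_lt hP hff hgg hfu hgu hx hy hfx hgy with ⟨c, hc⟩ | ⟨c, hc⟩
  · refine Or.inl (exists_smul_eq_of_evalRange_sub_lt hP hy hc
      (ih _ (Prod.mk_lt_mk_of_le_of_lt le_rfl hc) _ _ hfx ?_ rfl))
    rw [smul_sub, hgy, smul_smul, ← mul_assoc, hgg]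
  · refine Or.inr (exists_smul_eq_of_evalRange_sub_lt hP hx hc
      (ih _ (Prod.mk_lt_mk_of_lt_of_le hc le_rfl) _ _ ?_ hgy rfl).symm)
    rw [smul_sub, hfx, smul_smul, ← mul_assoc, hff]

lemma isUniserialLeftFix_of_isUniserialModule {f : Λ}
    (h : IsUniserialModule Λᵐᵒᵖ (Submodule.span Λᵐᵒᵖ {f})) : IsUniserialLeftFix f := by
  intro I I' hI hI'
  have key : ∀ I : Submodule Λᵐᵒᵖ Λ, (∀ a ∈ I, f * a = a) → I ≤ Submodule.span Λᵐᵒᵖ {f} :=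
    fun I hI a ha => Submodule.mem_span_singleton.mpr ⟨MulOpposite.op a, hI a ha⟩
  refine (h (I.submoduleOf _) (I'.submoduleOf _)).imp (fun hle a ha => ?_) fun hle a ha => ?_
  · exact hle (x := ⟨a, key I hI ha⟩) ha
  · exact hle (x := ⟨a, key I' hI' ha⟩) ha

lemma AllIndecUniserial.exists_idempotent_smul_notMem [IsArtinianRing Λᵐᵒᵖ]
    (hU : AllIndecUniserial Λ) {Q : Submodule Λ P} {x : P} (hx : x ∉ Q) :
    ∃ f : Λ, f * f = f ∧ IsUniserialLeftFix f ∧ f • x ∉ Q := by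
  have : Module.Finite Λᵐᵒᵖ Λ := moduleFinite_mulOpposite Λ
  have : IsArtinian Λᵐᵒᵖ Λ := inferInstance
  suffices H : ∀ I : Submodule Λᵐᵒᵖ Λ, ∀ f : Λ, Submodule.span Λᵐᵒᵖ {f} = I → f * f = f →
      f • x ∉ Q → ∃ f : Λ, f * f = f ∧ IsUniserialLeftFix f ∧ f • x ∉ Q from
    H _ 1 rfl (mul_one 1) (by rwa [one_smul])
  intro I
  induction I using WellFoundedLT.induction with
  | ind I ih =>
  rintro f rfl hff hfx
  by_cases hind : IsIndecModule Λᵐᵒᵖ (Submodule.span Λᵐᵒᵖ {f})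
  · exact ⟨f, hff, isUniserialLeftFix_of_isUniserialModule (hU _ hind), hfx⟩
  have hmem := Submodule.mem_span_singleton_self (R := Λᵐᵒᵖ) f
  have hnt : Nontrivial (Submodule.span Λᵐᵒᵖ {f}) := by
    refine ⟨⟨f, hmem⟩, 0, fun h => hfx ?_⟩
    have : f = 0 := congrArg Subtype.val h
    rw [this, zero_smul]; exact Q.zero_mem
  simp only [IsIndecModule, hnt, true_and] at hind
  push Not at hind
  obtain ⟨N, N', hc, hN, hN'⟩ := hind
  have key : ∀ N N' : Submodule Λᵐᵒᵖ (Submodule.span Λᵐᵒᵖ {f}), IsCompl N N' → N' ≠ ⊥ →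
      ∀ a ∈ N, ∀ b ∈ N', a + b = ⟨f, hmem⟩ → (a : Λ) • x ∉ Q →
      ∃ f : Λ, f * f = f ∧ IsUniserialLeftFix f ∧ f • x ∉ Q := by
    intro N N' hc hN' a ha b hb hab hax
    have hfa : f * (a : Λ) = a := by
      obtain ⟨c, hc⟩ := Submodule.mem_span_singleton.mp a.2
      rw [← hc, MulOpposite.smul_eq_mul_unop, ← mul_assoc, hff]
    have haa : (a : Λ) * a = a := by
      have h1 : MulOpposite.op (a : Λ) • b = a - MulOpposite.op (a : Λ) • a := by
        rw [eq_sub_iff_add_eq, ← smul_add, add_comm b a, hab]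
        exact Subtype.ext hfa
      have h2 : MulOpposite.op (a : Λ) • b = 0 :=
        Submodule.disjoint_def.mp hc.disjoint _
          (h1 ▸ N.sub_mem ha (N.smul_mem _ ha)) (N'.smul_mem _ hb)
      rw [h2] at h1
      exact (congrArg Subtype.val (sub_eq_zero.mp h1.symm)).symm
    refine ih _ (lt_of_le_of_ne ?_ fun he => hN' ?_) a rfl haa hax
    · rw [Submodule.span_singleton_le_iff_mem]; exact a.2
    · have hfm : (⟨f, hmem⟩ : Submodule.span Λᵐᵒᵖ {f}) ∈ N := by
        obtain ⟨c, hc⟩ := Submodule.mem_span_singleton.mp (he ▸ hmem)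
        rw [← (Subtype.ext hc : c • a = ⟨f, hmem⟩)]
        exact N.smul_mem _ ha
      have : N = ⊤ := by
        rw [eq_top_iff]
        rintro ⟨z, hz⟩ -
        obtain ⟨c, rfl⟩ := Submodule.mem_span_singleton.mp hz
        exact N.smul_mem c hfm
      exact eq_bot_of_isCompl_top (this ▸ hc.symm)
  obtain ⟨a, ha, b, hb, hab⟩ := Submodule.mem_sup.mp
    (hc.sup_eq_top ▸ Submodule.mem_top : (⟨f, hmem⟩ : Submodule.span Λᵐᵒᵖ {f}) ∈ N ⊔ N')
  by_cases hax : (a : Λ) • x ∈ Q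
  · refine key N' N hc.symm hN b hb a ha (by rw [add_comm, hab]) fun hbx => hfx ?_
    have hab' : (a : Λ) + b = f := congrArg Subtype.val hab
    rw [← hab', add_smul]
    exact Q.add_mem hax hbx
  · exact key N N' hc hN' a ha b hb hab hax

end

theorem AllIndecUniserial.isNakayamaAlgebra [IsArtinianRing Λ] [IsArtinianRing Λᵐᵒᵖ]
    (hU : AllIndecUniserial Λ) : IsNakayamaAlgebra Λ := by
  refine ⟨fun M _ _ hM => hU M hM, fun P _ _ hP N N' => ?_⟩
  by_contra! h
  obtain ⟨x, hxN, hxN'⟩ := SetLike.not_le_iff_exists.mp h.1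
  obtain ⟨y, hyN', hyN⟩ := SetLike.not_le_iff_exists.mp h.2
  obtain ⟨f, hff, hfu, hfx⟩ := hU.exists_idempotent_smul_notMem hxN'
  obtain ⟨g, hgg, hgu, hgy⟩ := hU.exists_idempotent_smul_notMem hyN
  rcases hU.exists_smul_eq hP hff hgg hfu hgu (f • x) (g • y) (by rw [smul_smul, hff])
    (by rw [smul_smul, hgg]) with ⟨a, ha⟩ | ⟨a, ha⟩
  · exact hgy (ha ▸ N.smul_mem _ (N.smul_mem _ hxN))
  · exact hfx (ha ▸ N'.smul_mem _ (N'.smul_mem _ hyN'))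

end IndecomposableProjectives

section RightNakayama

variable {Λ : Type u} [Ring Λ]

variable (Λ) in
/-- Every finitely generated indecomposable right module is `i`-factor serial for some
`1 ≤ i ≤ n`. -/
def AllIndecFactorSerial (n : ℕ) : Prop :=
  ∀ M : ModuleCat.{u} Λᵐᵒᵖ, Module.Finite Λᵐᵒᵖ M → IsIndecModule Λᵐᵒᵖ M →
    ∃ i, 1 ≤ i ∧ i ≤ n ∧ IsFactorSerial Λᵐᵒᵖ M i

lemma AllIndecFactorSerial.of_succ {n : ℕ} (hn : 1 ≤ n) (h : AllIndecFactorSerial Λ (n + 1))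
    (h' : ¬ IsRightNNakayama Λ (n + 1)) : AllIndecFactorSerial Λ n := by
  intro M hM hind
  obtain ⟨i, hi, hin, hs⟩ := h M hM hind
  rcases hin.lt_or_eq with hlt | rfl
  · exact ⟨i, hi, Nat.lt_succ_iff.mp hlt, hs⟩
  · rcases hs with ⟨h1, -⟩ | hs
    · omega
    · exact absurd ⟨h, M, hM, hind, hs⟩ h'

lemma AllIndecFactorSerial.allIndecUniserial (h : AllIndecFactorSerial Λ 1) :
    AllIndecUniserial Λ := by
  intro M _ _ hM hind
  obtain ⟨i, -, hi, ⟨-, hs⟩ | ⟨h1, -⟩⟩ := h (ModuleCat.of _ M) hM hind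
  · exact hs
  · omega

lemma IsRightNNakayama.uniserial_top {M : Type u} [AddCommGroup M] [Module Λᵐᵒᵖ M]
    [Module.Finite Λᵐᵒᵖ M] {n : ℕ} (h : IsRightNNakayama Λ n) (hM : IsIndecModule Λᵐᵒᵖ M)
    (hn : (n : WithBot ℕ∞) < moduleLength Λᵐᵒᵖ M) :
    IsUniserialModule Λᵐᵒᵖ (M ⧸ moduleRad Λᵐᵒᵖ M) := by
  obtain ⟨i, -, hi, hs⟩ := h.1 (ModuleCat.of _ M) ‹_› hM
  exact IsFactorSerial.uniserial_top (M := M) hs (lt_of_le_of_lt (by exact_mod_cast hi) hn)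

lemma IsRightNNakayama.isUniserialModule [IsArtinianRing Λᵐᵒᵖ] {M : Type u} [AddCommGroup M]
    [Module Λᵐᵒᵖ M] [Module.Finite Λᵐᵒᵖ M] (h : IsRightNNakayama Λ 4) (hM : IsIndecModule Λᵐᵒᵖ M)
    (hl : 5 < moduleLength Λᵐᵒᵖ M) : IsUniserialModule Λᵐᵒᵖ M := by
  obtain ⟨i, -, hi, ⟨-, hs⟩ | hs⟩ := h.1 (ModuleCat.of _ M) ‹_› hM
  · exact hs
  obtain ⟨m, S, T, hX, hX5, hXtop⟩ := IsNFactorSerial.exists_pairModule (M := M) hs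
    (lt_of_le_of_lt (b := ((5 : ℕ) : WithBot ℕ∞)) (by exact_mod_cast Nat.succ_le_succ hi) hl)
  refine absurd (h.uniserial_top hX (lt_of_lt_of_le ?_ hX5)) hXtop
  exact_mod_cast Nat.lt_succ_self 4

lemma allIndecFactorSerial_four [IsArtinianRing Λᵐᵒᵖ]
    (h : ∀ (M : Type u) [AddCommGroup M] [Module Λᵐᵒᵖ M] [Module.Finite Λᵐᵒᵖ M],
      IsIndecModule Λᵐᵒᵖ M →
        ((5 : WithBot ℕ∞) < moduleLength Λᵐᵒᵖ M → IsUniserialModule Λᵐᵒᵖ M) ∧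
        (moduleLength Λᵐᵒᵖ M = (5 : ℕ) → IsLocalModule Λᵐᵒᵖ M)) : AllIndecFactorSerial Λ 4 := by
  intro M _ hM
  by_cases hU : IsUniserialModule Λᵐᵒᵖ M
  · exact ⟨1, le_rfl, by omega, Or.inl ⟨rfl, hU⟩⟩
  obtain ⟨l, hl⟩ := exists_moduleLength_eq (A := Λᵐᵒᵖ) (M := M)
  obtain ⟨n, hnl, hn, hlt⟩ := exists_isNFactorSerial hl hU
  refine ⟨n, hn.1.le, ?_, Or.inr hn⟩
  have hl5 : l ≤ 5 := by
    by_contra! h5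
    refine hU ((h M hM).1 ?_)
    rw [hl]
    exact_mod_cast h5
  rcases hl5.lt_or_eq with h5 | rfl
  · omega
  · have := hlt ((h M hM).2 hl).uniserial_top
    omega

end RightNakayama

theorem right_four_nakayama_characterization
    (R : Type*) [CommRing R] [IsArtinianRing R]
    (Λ : Type u) [Ring Λ] [Algebra R Λ] [Module.Finite R Λ]
    (h1 : ¬ IsNakayamaAlgebra Λ) (h2 : ¬ IsRightNNakayama Λ 2)
    (h3 : ¬ IsRightNNakayama Λ 3) :
    IsRightNNakayama Λ 4 ↔
      ∀ (M : Type u) [AddCommGroup M] [Module Λᵐᵒᵖ M] [Module.Finite Λᵐᵒᵖ M],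
        IsIndecModule Λᵐᵒᵖ M →
          ((5 : WithBot ℕ∞) < moduleLength Λᵐᵒᵖ M → IsUniserialModule Λᵐᵒᵖ M) ∧
          (moduleLength Λᵐᵒᵖ M = (5 : ℕ) → IsLocalModule Λᵐᵒᵖ M) := by
  have : IsArtinianRing Λ := IsArtinianRing.of_finite R Λ
  have : Module.Finite R Λᵐᵒᵖ := Module.Finite.equiv (MulOpposite.opLinearEquiv R)
  have : IsArtinianRing Λᵐᵒᵖ := IsArtinianRing.of_finite R Λᵐᵒᵖ
  constructor
  · intro h M _ _ _ hM
    refine ⟨h.isUniserialModule hM, fun hl => ?_⟩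
    have := hM.1
    refine isLocalModule_of_uniserial_top (h.uniserial_top hM ?_)
    rw [hl]
    exact_mod_cast Nat.lt_succ_self 4
  · intro h
    have hall := allIndecFactorSerial_four h
    by_contra h4
    exact h1 (((hall.of_succ (by omega) h4).of_succ (by omega) h3).of_succ le_rfl
      h2).allIndecUniserial.isNakayamaAlgebra
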